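/- Let γ = (ξ,η) ∈ 𝒢, let D, T ∈ ℕ*, let P ∈ ℂ[X]_D with P ≠ 0, and let α = (α₀,α₁,α₂) ∈ ℂ³ with ‖α‖ = 1 and dist(α,(1:γ)) ≤ (2c₂(γ))⁻¹ (so that α₀ ≠ 0). Then |P(α)|/‖P‖ ≤ c₄·max_{0 ≤ i < T} |𝒟^i P(1,ξ,η)|/‖P‖ + c₄^D·(dist(α,(1:γ))^T + dist(α,A_γ)), where c₄ = 3c₂(γ)·exp(2c₂(γ)²). -/

import Mathlib

open MvPolynomial

/-- The derivation `𝒟 = X₀·∂/∂X₁ + X₂·∂/∂X₂` of `ℂ[X₀,X₁,X₂]`. -/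
noncomputable def DD : MvPolynomial (Fin 3) ℂ → MvPolynomial (Fin 3) ℂ :=
  fun P => X 0 * pderiv 1 P + X 2 * pderiv 2 P

/-- The norm of a polynomial: the max of the absolute values of its coefficients. -/
noncomputable def pnorm (P : MvPolynomial (Fin 3) ℂ) : ℝ :=
  ((P.support.sup fun v => ‖P.coeff v‖₊ : NNReal) : ℝ)

/-- The length of a polynomial: the sum of the absolute values of its coefficients. -/
noncomputable def plen (P : MvPolynomial (Fin 3) ℂ) : ℝ :=
  ∑ v ∈ P.support, ‖P.coeff v‖

/-- The automorphism `τ_γ` of `ℂ[X₀,X₁,X₂]`, `τ_γ(P)(X₀,X₁,X₂) = P(X₀, ξX₀+X₁, ηX₂)`. -/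
noncomputable def tauG (ξ η : ℂ) : MvPolynomial (Fin 3) ℂ →ₐ[ℂ] MvPolynomial (Fin 3) ℂ :=
  aeval ![X 0, C ξ * X 0 + X 1, C η * X 2]

/-- The ideal `I^{(γ,T)}` generated by the homogeneous polynomials all of whose
derivatives `𝒟^i P`, `0 ≤ i < T`, vanish at `(1,ξ,η)`. -/
noncomputable def Igam (ξ η : ℂ) (T : ℕ) : Ideal (MvPolynomial (Fin 3) ℂ) :=
  Ideal.span {P | (∃ d, P.IsHomogeneous d) ∧ ∀ i < T, eval ![1, ξ, η] (DD^[i] P) = 0}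

noncomputable def c2c (ξ η : ℂ) : ℝ := max 1 (max ‖ξ‖ ‖η‖)

noncomputable def c3c (ξ η : ℂ) : ℝ := (2 + ‖ξ‖ + ‖η‖⁻¹) * c2c ξ η

noncomputable def c4c (ξ η : ℂ) : ℝ := 3 * c2c ξ η * Real.exp (2 * (c2c ξ η) ^ 2)

noncomputable def c5c (ξ η : ℂ) : ℝ := (2 * c2c ξ η + 3) * (c3c ξ η) ^ 2

/-- Projective distance from `α` (of norm 1) to the point `(1:ξ:η)`. -/
noncomputable def pdist (ξ η α₀ α₁ α₂ : ℂ) : ℝ :=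
  (c2c ξ η)⁻¹ * max ‖α₁ - α₀ * ξ‖ (max ‖α₂ - α₀ * η‖ ‖α₁ * η - α₂ * ξ‖)

/-- Distance from `α` to the analytic curve `A_γ = {(1:ξ+z:ηe^z)}`. -/
noncomputable def adist (ξ η α₀ α₁ α₂ : ℂ) : ℝ :=
  ‖α₂ / α₀ - η * Complex.exp (α₁ / α₀ - ξ)‖

/-- `|I^{(γ,T)}_D|_α = sup{|P(α)| : P ∈ I^{(γ,T)}_D, ‖P‖ ≤ 1}`. -/
noncomputable def Isup (ξ η : ℂ) (T D : ℕ) (α : Fin 3 → ℂ) : ℝ :=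
  sSup {x : ℝ | ∃ P : MvPolynomial (Fin 3) ℂ,
    P ∈ Igam ξ η T ∧ P.IsHomogeneous D ∧ pnorm P ≤ 1 ∧ x = ‖eval α P‖}

lemma sum_eq_of_mem_support {P : MvPolynomial (Fin 3) ℂ} {D : ℕ} (hP : P.IsHomogeneous D)
    {v : Fin 3 →₀ ℕ} (hv : v ∈ P.support) : v 0 + v 1 + v 2 = D := by
  by_contra h
  refine mem_support_iff.mp hv (hP.coeff_eq_zero ?_)
  rwa [Finsupp.degree_eq_sum, Fin.sum_univ_three]

lemma eval_vec_eq (x y z : ℂ) (P : MvPolynomial (Fin 3) ℂ) :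
    eval ![x, y, z] P = ∑ v ∈ P.support, P.coeff v * (x ^ v 0 * y ^ v 1 * z ^ v 2) := by
  simp [eval_eq', Fin.prod_univ_three]

lemma plen_nonneg (P : MvPolynomial (Fin 3) ℂ) : 0 ≤ plen P :=
  Finset.sum_nonneg fun _ _ => norm_nonneg _

lemma plen_eq_sum {P : MvPolynomial (Fin 3) ℂ} {s : Finset (Fin 3 →₀ ℕ)} (h : P.support ⊆ s) :
    plen P = ∑ v ∈ s, ‖P.coeff v‖ :=
  Finset.sum_subset h fun v _ hv => by simp [notMem_support_iff.mp hv]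

lemma plen_add_le (P Q : MvPolynomial (Fin 3) ℂ) : plen (P + Q) ≤ plen P + plen Q := by
  classical
  rw [plen_eq_sum support_add, plen_eq_sum (P := P) Finset.subset_union_left,
    plen_eq_sum (P := Q) Finset.subset_union_right, ← Finset.sum_add_distrib]
  exact Finset.sum_le_sum fun v _ => by rw [coeff_add]; exact norm_add_le _ _

lemma plen_zero : plen 0 = 0 := by simp [plen]

lemma plen_sum_le {ι : Type*} (s : Finset ι) (f : ι → MvPolynomial (Fin 3) ℂ) :
    plen (∑ i ∈ s, f i) ≤ ∑ i ∈ s, plen (f i) :=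
  Finset.le_sum_of_subadditive plen plen_zero.le plen_add_le s f

lemma plen_monomial (v : Fin 3 →₀ ℕ) (a : ℂ) : plen (monomial v a) = ‖a‖ := by
  rw [plen_eq_sum support_monomial_subset]
  simp

lemma DD_sum {ι : Type*} (s : Finset ι) (f : ι → MvPolynomial (Fin 3) ℂ) :
    DD (∑ i ∈ s, f i) = ∑ i ∈ s, DD (f i) := by
  simp only [DD, map_sum, Finset.mul_sum, Finset.sum_add_distrib]

lemma plen_DD_monomial_le (v : Fin 3 →₀ ℕ) (a : ℂ) :
    plen (DD (monomial v a)) ≤ (v 1 + v 2 : ℕ) * ‖a‖ := by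
  refine (plen_add_le _ _).trans (le_of_eq ?_)
  rw [pderiv_monomial, pderiv_monomial, X, X, monomial_mul, monomial_mul, plen_monomial,
    plen_monomial]
  simp
  ring

lemma plen_DD_le {P : MvPolynomial (Fin 3) ℂ} {D : ℕ} (hP : P.IsHomogeneous D) :
    plen (DD P) ≤ D * plen P := by
  conv_lhs => rw [P.as_sum, DD_sum]
  refine (plen_sum_le _ _).trans ?_
  rw [plen, Finset.mul_sum]
  refine Finset.sum_le_sum fun v hv => (plen_DD_monomial_le _ _).trans ?_
  have := sum_eq_of_mem_support hP hv
  gcongr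
  omega

lemma isHomogeneous_DD {P : MvPolynomial (Fin 3) ℂ} {D : ℕ} (hP : P.IsHomogeneous D)
    (hD : 0 < D) : (DD P).IsHomogeneous D := by
  have h (i j : Fin 3) : (X i * pderiv j P).IsHomogeneous D := by
    have := (isHomogeneous_X ℂ i).mul (hP.pderiv (i := j))
    rwa [Nat.add_sub_cancel' hD] at this
  exact (h 0 1).add (h 2 2)

lemma norm_eval_le {P : MvPolynomial (Fin 3) ℂ} {D : ℕ} (hP : P.IsHomogeneous D) {x y z : ℂ}
    {c : ℝ} (hx : ‖x‖ ≤ c) (hy : ‖y‖ ≤ c) (hz : ‖z‖ ≤ c) :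
    ‖eval ![x, y, z] P‖ ≤ c ^ D * plen P := by
  have hc : 0 ≤ c := (norm_nonneg x).trans hx
  rw [eval_vec_eq, plen, Finset.mul_sum]
  refine norm_sum_le_of_le _ fun v hv => ?_
  rw [← sum_eq_of_mem_support hP hv, norm_mul, mul_comm, norm_mul, norm_mul, norm_pow, norm_pow,
    norm_pow, pow_add, pow_add]
  gcongr

lemma norm_eval_DD_iterate_le {D : ℕ} (hD : 0 < D) {x y z : ℂ} {c : ℝ} (hx : ‖x‖ ≤ c)
    (hy : ‖y‖ ≤ c) (hz : ‖z‖ ≤ c) (n : ℕ) {P : MvPolynomial (Fin 3) ℂ}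
    (hP : P.IsHomogeneous D) :
    ‖eval ![x, y, z] (DD^[n] P)‖ ≤ c ^ D * plen P * D ^ n := by
  have hc : 0 ≤ c := (norm_nonneg x).trans hx
  induction n generalizing P with
  | zero => simpa using norm_eval_le hP hx hy hz
  | succ n ih =>
    rw [Function.iterate_succ_apply]
    calc _ ≤ c ^ D * plen (DD P) * D ^ n := ih (isHomogeneous_DD hP hD)
      _ ≤ c ^ D * (D * plen P) * D ^ n := by gcongr; exact plen_DD_le hP
      _ = _ := by ring

lemma choose_add_two_le (D : ℕ) : (D + 2).choose 2 ≤ 3 ^ D := by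
  induction D with
  | zero => simp
  | succ D ih =>
    have h : D + 2 ≤ 2 * 3 ^ D := by
      clear ih
      induction D with
      | zero => simp
      | succ D ih => rw [pow_succ]; omega
    rw [show D + 1 + 2 = (D + 2) + 1 by ring, Nat.choose_succ_succ' (D + 2) 1, Nat.choose_one_right,
      pow_succ, one_add_one_eq_two]
    omega

lemma card_support_le {P : MvPolynomial (Fin 3) ℂ} {D : ℕ} (hP : P.IsHomogeneous D) :
    P.support.card ≤ 3 ^ D := by
  have h : P.support ⊆ Finset.finsuppAntidiag Finset.univ D := fun v hv => by
    simpa [Finset.mem_finsuppAntidiag, Fin.sum_univ_three] using sum_eq_of_mem_support hP hv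
  refine (Finset.card_le_card h).trans (le_trans (le_of_eq ?_) (choose_add_two_le D))
  rw [Finset.card_finsuppAntidiag_nat_eq_choose, Finset.card_univ, Fintype.card_fin,
    show 3 + D - 1 = D + 2 by omega, Nat.choose_symm_add]

lemma norm_coeff_le_pnorm (P : MvPolynomial (Fin 3) ℂ) {v : Fin 3 →₀ ℕ} (hv : v ∈ P.support) :
    ‖P.coeff v‖ ≤ pnorm P := by
  have := Finset.le_sup (f := fun v => ‖P.coeff v‖₊) hv
  exact_mod_cast this

lemma pnorm_pos {P : MvPolynomial (Fin 3) ℂ} (hP : P ≠ 0) : 0 < pnorm P := by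
  obtain ⟨v, hv⟩ := support_nonempty.mpr hP
  exact (norm_pos_iff.mpr (mem_support_iff.mp hv)).trans_le (norm_coeff_le_pnorm P hv)

lemma plen_le_pnorm {P : MvPolynomial (Fin 3) ℂ} {D : ℕ} (hP : P.IsHomogeneous D) :
    plen P ≤ 3 ^ D * pnorm P := by
  refine (Finset.sum_le_card_nsmul _ _ _ fun v hv => norm_coeff_le_pnorm P hv).trans ?_
  rw [nsmul_eq_mul]
  gcongr
  · exact NNReal.coe_nonneg _
  · exact_mod_cast card_support_le hP

lemma hasDerivAt_eval_curve (ξ η : ℂ) (P : MvPolynomial (Fin 3) ℂ) (t : ℂ) :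
    HasDerivAt (fun t => eval ![1, ξ + t, η * Complex.exp t] P)
      (eval ![1, ξ + t, η * Complex.exp t] (DD P)) t := by
  induction P using MvPolynomial.induction_on with
  | C a => simpa [DD] using hasDerivAt_const t a
  | add P Q hP hQ =>
    convert! hP.add hQ using 1
    · ext; simp
    · simp [DD]; ring
  | mul_X P i hP =>
    have hX : HasDerivAt (fun t => eval ![1, ξ + t, η * Complex.exp t] (X i))
        (eval ![1, ξ + t, η * Complex.exp t] (DD (X i))) t := by
      fin_cases i
      · simpa [DD, pderiv_X] using hasDerivAt_const t (1 : ℂ)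
      · simpa [DD, pderiv_X] using (hasDerivAt_id t).const_add ξ
      · simpa [DD, pderiv_X] using (Complex.hasDerivAt_exp t).const_mul η
    convert! hP.mul hX using 1
    · ext; simp
    · simp [DD]; ring

lemma iteratedDeriv_eval_curve (ξ η : ℂ) (n : ℕ) (P : MvPolynomial (Fin 3) ℂ) :
    iteratedDeriv n (fun t => eval ![1, ξ + t, η * Complex.exp t] P) =
      fun t => eval ![1, ξ + t, η * Complex.exp t] (DD^[n] P) := by
  induction n generalizing P with
  | zero => simp
  | succ n ih =>
    rw [iteratedDeriv_succ', Function.iterate_succ_apply, ← ih]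
    congr 1
    ext t
    exact (hasDerivAt_eval_curve ξ η P t).deriv

lemma hasSum_eval_curve (ξ η z : ℂ) (P : MvPolynomial (Fin 3) ℂ) :
    HasSum (fun n : ℕ => z ^ n / n.factorial * eval ![1, ξ, η] (DD^[n] P))
      (eval ![1, ξ + z, η * Complex.exp z] P) := by
  have h := Complex.hasSum_taylorSeries_of_entire
    (f := fun t => eval ![1, ξ + t, η * Complex.exp t] P)
    (fun t => (hasDerivAt_eval_curve ξ η P t).differentiableAt) 0 z
  refine h.congr_fun fun n => ?_
  simp [iteratedDeriv_eval_curve]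
  ring

lemma hasSum_exp (x : ℝ) : HasSum (fun n : ℕ => x ^ n / n.factorial) (Real.exp x) := by
  rw [Real.exp_eq_exp_ℝ]
  exact NormedSpace.expSeries_div_hasSum_exp x

lemma norm_eval_curve_le {D T : ℕ} (hD : 0 < D) {P : MvPolynomial (Fin 3) ℂ}
    (hP : P.IsHomogeneous D) {ξ η z : ℂ} {c δ r M : ℝ} (hc : 1 ≤ c) (hξ : ‖ξ‖ ≤ c) (hη : ‖η‖ ≤ c)
    (hδ : 0 ≤ δ) (hδ1 : δ ≤ 1) (hr : 0 ≤ r) (hz : ‖z‖ ≤ r * δ) (hM0 : 0 ≤ M)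
    (hM : ∀ i < T, ‖eval ![1, ξ, η] (DD^[i] P)‖ ≤ M) :
    ‖eval ![1, ξ + z, η * Complex.exp z] P‖ ≤
      M * Real.exp ‖z‖ + δ ^ T * (c ^ D * plen P) * Real.exp (r * D) := by
  refine (hasSum_eval_curve ξ η z P).norm_le_of_bounded
    (((hasSum_exp ‖z‖).mul_left M).add
      ((hasSum_exp (r * D)).mul_left (δ ^ T * (c ^ D * plen P)))) fun n => ?_
  have hL := plen_nonneg P
  have hnorm : ‖z ^ n / n.factorial * eval ![1, ξ, η] (DD^[n] P)‖ =
      ‖z‖ ^ n / n.factorial * ‖eval ![1, ξ, η] (DD^[n] P)‖ := by simp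
  rw [hnorm]
  rcases lt_or_ge n T with h | h
  · rw [mul_comm M]
    refine (mul_le_mul_of_nonneg_left (hM n h) (by positivity)).trans
      (le_add_of_nonneg_right (by positivity))
  · refine le_trans ?_ (le_add_of_nonneg_left (by positivity))
    calc _ ≤ (r * δ) ^ n / n.factorial * (c ^ D * plen P * D ^ n) := by
          gcongr
          exact norm_eval_DD_iterate_le hD (by simpa using hc) hξ hη n hP
      _ = δ ^ n * (c ^ D * plen P) * ((r * D) ^ n / n.factorial) := by ring
      _ ≤ _ := by
          gcongr ?_ * _ * _
          exact pow_le_pow_of_le_one hδ hδ1 h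

lemma norm_pow_sub_pow_le {x y : ℂ} {M : ℝ} (hM : 1 ≤ M) (hx : ‖x‖ ≤ M) (hy : ‖y‖ ≤ M) (n : ℕ) :
    ‖x ^ n - y ^ n‖ ≤ n * M ^ n * ‖x - y‖ := by
  induction n with
  | zero => simp
  | succ n ih =>
    calc ‖x ^ (n + 1) - y ^ (n + 1)‖ = ‖x * (x ^ n - y ^ n) + (x - y) * y ^ n‖ := by
          congr 1; ring
      _ ≤ ‖x‖ * ‖x ^ n - y ^ n‖ + ‖x - y‖ * ‖y‖ ^ n := by
          simpa using norm_add_le (x * (x ^ n - y ^ n)) ((x - y) * y ^ n)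
      _ ≤ M * (n * M ^ n * ‖x - y‖) + ‖x - y‖ * M ^ (n + 1) := by
          gcongr ?_ * ?_ + _ * ?_
          exact (pow_le_pow_left₀ (norm_nonneg _) hy n).trans (pow_le_pow_right₀ hM n.le_succ)
      _ = _ := by push_cast; ring

lemma norm_eval_sub_eval_le {D : ℕ} {P : MvPolynomial (Fin 3) ℂ} (hP : P.IsHomogeneous D)
    {x y z w : ℂ} {M : ℝ} (hM : 1 ≤ M) (hx : ‖x‖ ≤ M) (hy : ‖y‖ ≤ M) (hz : ‖z‖ ≤ M)
    (hw : ‖w‖ ≤ M) :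
    ‖eval ![x, y, z] P - eval ![x, y, w] P‖ ≤ D * M ^ D * ‖z - w‖ * plen P := by
  rw [eval_vec_eq, eval_vec_eq, ← Finset.sum_sub_distrib, plen, Finset.mul_sum]
  refine norm_sum_le_of_le _ fun v hv => ?_
  have hv' := sum_eq_of_mem_support hP hv
  calc _ = ‖x‖ ^ v 0 * ‖y‖ ^ v 1 * ‖z ^ v 2 - w ^ v 2‖ * ‖P.coeff v‖ := by
        simp only [← norm_pow, ← norm_mul]; congr 1; ring
    _ ≤ M ^ v 0 * M ^ v 1 * (v 2 * M ^ v 2 * ‖z - w‖) * ‖P.coeff v‖ := by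
        gcongr
        exact norm_pow_sub_pow_le hM hz hw _
    _ = v 2 * M ^ (v 0 + v 1 + v 2) * ‖z - w‖ * ‖P.coeff v‖ := by ring
    _ ≤ _ := by
        rw [hv']
        gcongr
        omega

lemma eval_mul_vec {D : ℕ} {P : MvPolynomial (Fin 3) ℂ} (hP : P.IsHomogeneous D) (a x y z : ℂ) :
    eval ![a * x, a * y, a * z] P = a ^ D * eval ![x, y, z] P := by
  rw [eval_vec_eq, eval_vec_eq, Finset.mul_sum]
  refine Finset.sum_congr rfl fun v hv => ?_
  rw [← sum_eq_of_mem_support hP hv]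
  ring

lemma inv_two_mul_c2c_le {ξ η α₀ α₁ α₂ : ℂ} (hα : max ‖α₀‖ (max ‖α₁‖ ‖α₂‖) = 1)
    (hd : pdist ξ η α₀ α₁ α₂ ≤ (2 * c2c ξ η)⁻¹) : (2 * c2c ξ η)⁻¹ ≤ ‖α₀‖ := by
  have hc : 1 ≤ c2c ξ η := le_max_left _ _
  have hξ : ‖ξ‖ ≤ c2c ξ η := (le_max_left _ _).trans (le_max_right _ _)
  have hη : ‖η‖ ≤ c2c ξ η := (le_max_right _ _).trans (le_max_right _ _)
  rw [pdist] at hd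
  set c := c2c ξ η
  have hc0 : 0 < c := one_pos.trans_le hc
  rw [inv_mul_le_iff₀ hc0, show c * (2 * c)⁻¹ = 1 / 2 by field_simp, max_le_iff, max_le_iff] at hd
  have key {a b : ℂ} (ha : ‖a‖ = 1) (hb : ‖b‖ ≤ c) (h : ‖a - α₀ * b‖ ≤ 1 / 2) :
      1 / 2 ≤ ‖α₀‖ * c := by
    have h1 := norm_sub_norm_le a (α₀ * b)
    rw [norm_mul, ha] at h1
    have h2 := mul_le_mul_of_nonneg_left hb (norm_nonneg α₀)
    linarith
  rw [inv_le_iff_one_le_mul₀ (by positivity)]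
  suffices 1 / 2 ≤ ‖α₀‖ * c by linarith
  rcases max_choice ‖α₀‖ (max ‖α₁‖ ‖α₂‖) with h | h
  · rw [← h, hα]; linarith
  · rcases max_choice ‖α₁‖ ‖α₂‖ with h' | h'
    · exact key (by rw [← h', ← h, hα]) hξ hd.1
    · exact key (by rw [← h', ← h, hα]) hη hd.2.1

lemma norm_eval_le_of_pdist_le {ξ η : ℂ} {D T : ℕ} (hD : 0 < D) {P : MvPolynomial (Fin 3) ℂ}
    (hP : P.IsHomogeneous D) {α₀ α₁ α₂ : ℂ} (hα : max ‖α₀‖ (max ‖α₁‖ ‖α₂‖) = 1)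
    (hd : pdist ξ η α₀ α₁ α₂ ≤ (2 * c2c ξ η)⁻¹) {M : ℝ} (hM0 : 0 ≤ M)
    (hM : ∀ i < T, ‖eval ![1, ξ, η] (DD^[i] P)‖ ≤ M) :
    ‖eval ![α₀, α₁, α₂] P‖ ≤ c4c ξ η * M +
      c4c ξ η ^ D * (pdist ξ η α₀ α₁ α₂ ^ T + adist ξ η α₀ α₁ α₂) * pnorm P := by
  have hα₀ := inv_two_mul_c2c_le hα hd
  have hc : 1 ≤ c2c ξ η := le_max_left _ _
  have hξ : ‖ξ‖ ≤ c2c ξ η := (le_max_left _ _).trans (le_max_right _ _)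
  have hη : ‖η‖ ≤ c2c ξ η := (le_max_right _ _).trans (le_max_right _ _)
  have hδ0 : 0 ≤ pdist ξ η α₀ α₁ α₂ := by unfold pdist; positivity
  have hδα : ‖α₁ - α₀ * ξ‖ ≤ c2c ξ η * pdist ξ η α₀ α₁ α₂ := by
    rw [pdist, mul_inv_cancel_left₀ (by positivity)]
    exact le_max_left _ _
  rw [c4c, adist]
  set c := c2c ξ η
  set δ := pdist ξ η α₀ α₁ α₂
  have hα₀1 : ‖α₀‖ ≤ 1 := hα ▸ le_max_left _ _
  have hα₁1 : ‖α₁‖ ≤ 1 := hα ▸ (le_max_left _ _).trans (le_max_right _ _)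
  have hα₂1 : ‖α₂‖ ≤ 1 := hα ▸ (le_max_right _ _).trans (le_max_right _ _)
  have hα₀pos : 0 < ‖α₀‖ := lt_of_lt_of_le (by positivity) hα₀
  have hα₀0 : α₀ ≠ 0 := norm_pos_iff.mp hα₀pos
  set z := α₁ / α₀ - ξ with hz
  have hzr : ‖z‖ ≤ 2 * c ^ 2 * δ := by
    rw [show z = (α₁ - α₀ * ξ) / α₀ by rw [hz]; field_simp, norm_div, div_le_iff₀ hα₀pos]
    rw [inv_le_iff_one_le_mul₀ (by positivity)] at hα₀
    calc _ ≤ c * δ * 1 := by linarith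
      _ ≤ c * δ * (‖α₀‖ * (2 * c)) := by gcongr
      _ = _ := by ring
  have hzc : ‖z‖ ≤ c := by
    refine hzr.trans ?_
    calc _ ≤ 2 * c ^ 2 * (2 * c)⁻¹ := by gcongr
      _ = c := by field_simp
  have hδ1 : δ ≤ 1 := hd.trans (inv_le_one_of_one_le₀ (by linarith))
  have hcc : c + 1 ≤ 2 * c ^ 2 := by nlinarith
  have hw : ‖α₀ * (η * Complex.exp z)‖ ≤ c * Real.exp c := by
    rw [norm_mul, norm_mul, Complex.norm_exp]
    calc _ ≤ 1 * (c * Real.exp c) := by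
          gcongr
          exact (Complex.re_le_norm z).trans hzc
      _ = _ := one_mul _
  have h1M : 1 ≤ c * Real.exp c := one_le_mul_of_one_le_of_one_le hc (Real.one_le_exp (by linarith))
  have hscale : eval ![α₀, α₁, α₀ * (η * Complex.exp z)] P =
      α₀ ^ D * eval ![1, ξ + z, η * Complex.exp z] P := by
    rw [← eval_mul_vec hP]
    congr 3
    · simp
    · rw [hz]; field_simp; ring_nf
  have hsub := norm_eval_sub_eval_le hP h1M (hα₀1.trans h1M) (hα₁1.trans h1M) (hα₂1.trans h1M) hw
  have hcurve := norm_eval_curve_le hD hP hc hξ hη hδ0 hδ1 (by positivity) hzr hM0 hM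
  have hadist : ‖α₂ - α₀ * (η * Complex.exp z)‖ ≤ ‖α₂ / α₀ - η * Complex.exp z‖ := by
    rw [show α₂ - α₀ * (η * Complex.exp z) = α₀ * (α₂ / α₀ - η * Complex.exp z) by field_simp,
      norm_mul]
    exact mul_le_of_le_one_left (norm_nonneg _) hα₀1
  have hDexp : D * (c * Real.exp c) ^ D ≤ (c * Real.exp (2 * c ^ 2)) ^ D := by
    calc D * (c * Real.exp c) ^ D ≤ Real.exp 1 ^ D * (c * Real.exp c) ^ D := by
          gcongr
          rw [Real.exp_one_pow]
          linarith [Real.add_one_le_exp (D : ℝ)]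
      _ = (c * Real.exp (c + 1)) ^ D := by rw [← mul_pow, Real.exp_add]; ring
      _ ≤ _ := by gcongr
  have hexp : c ^ D * Real.exp (2 * c ^ 2 * D) = (c * Real.exp (2 * c ^ 2)) ^ D := by
    rw [mul_pow, ← Real.exp_nat_mul, mul_comm (D : ℝ)]
  set ε := ‖α₂ / α₀ - η * Complex.exp z‖
  have hL := plen_nonneg P
  calc ‖eval ![α₀, α₁, α₂] P‖
      ≤ ‖eval ![α₀, α₁, α₀ * (η * Complex.exp z)] P‖ +
        ‖eval ![α₀, α₁, α₂] P - eval ![α₀, α₁, α₀ * (η * Complex.exp z)] P‖ :=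
        norm_le_insert' _ _
    _ ≤ (M * Real.exp ‖z‖ + δ ^ T * (c ^ D * plen P) * Real.exp (2 * c ^ 2 * D)) +
        D * (c * Real.exp c) ^ D * ε * plen P := by
        refine add_le_add ?_ (hsub.trans (by gcongr))
        rw [hscale, norm_mul, norm_pow]
        exact (mul_le_of_le_one_left (norm_nonneg _)
          (pow_le_one₀ (norm_nonneg _) hα₀1)).trans hcurve
    _ ≤ (M * (3 * c * Real.exp (2 * c ^ 2)) +
          δ ^ T * (c ^ D * plen P) * Real.exp (2 * c ^ 2 * D)) +
        (c * Real.exp (2 * c ^ 2)) ^ D * ε * plen P := by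
        gcongr
        calc Real.exp ‖z‖ ≤ Real.exp (2 * c ^ 2) := by gcongr; linarith
          _ ≤ _ := le_mul_of_one_le_left (Real.exp_nonneg _) (by linarith)
    _ = 3 * c * Real.exp (2 * c ^ 2) * M +
        (c * Real.exp (2 * c ^ 2)) ^ D * (δ ^ T + ε) * plen P := by rw [← hexp]; ring
    _ ≤ 3 * c * Real.exp (2 * c ^ 2) * M +
        (c * Real.exp (2 * c ^ 2)) ^ D * (δ ^ T + ε) * (3 ^ D * pnorm P) := by
        gcongr
        exact plen_le_pnorm hP
    _ = _ := by rw [mul_assoc 3 c, mul_pow 3]; ring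

theorem stmt10 (ξ η : ℂ) (hη : η ≠ 0) (D T : ℕ) (hD : 0 < D) (hT : 0 < T)
    (P : MvPolynomial (Fin 3) ℂ) (hPh : P.IsHomogeneous D) (hP0 : P ≠ 0)
    (α₀ α₁ α₂ : ℂ) (hα : max ‖α₀‖ (max ‖α₁‖ ‖α₂‖) = 1)
    (hd : pdist ξ η α₀ α₁ α₂ ≤ (2 * c2c ξ η)⁻¹) :
    ‖eval ![α₀, α₁, α₂] P‖ / pnorm P ≤
      c4c ξ η * (Finset.range T).sup' (Finset.nonempty_range_iff.mpr hT.ne')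
          (fun i => ‖eval ![1, ξ, η] (DD^[i] P)‖ / pnorm P) +
        c4c ξ η ^ D * (pdist ξ η α₀ α₁ α₂ ^ T + adist ξ η α₀ α₁ α₂) := by
  have hpos := pnorm_pos hP0
  set S := (Finset.range T).sup' (Finset.nonempty_range_iff.mpr hT.ne')
    (fun i => ‖eval ![1, ξ, η] (DD^[i] P)‖ / pnorm P) with hS
  have hM (i : ℕ) (hi : i < T) : ‖eval ![1, ξ, η] (DD^[i] P)‖ ≤ S * pnorm P := by
    rw [← div_le_iff₀ hpos]
    exact Finset.le_sup' (fun i => ‖eval ![1, ξ, η] (DD^[i] P)‖ / pnorm P)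
      (Finset.mem_range.mpr hi)
  have h := norm_eval_le_of_pdist_le hD hPh hα hd ((norm_nonneg _).trans (hM 0 hT)) hM
  rw [div_le_iff₀ hpos]
  linarith
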